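/- Let v > 4 be an even integer with prime factorization v = p₁^{n₁}···p_k^{n_k}. Then the number of orbits of the affine group AGL₁(v) acting on B_con(v,3) — equivalently, the number of isomorphism classes of connected cyclic configurations of type (v_3) — equals (1/6)·v·∏_{i=1}^{k}(1 + 1/p_i) + β·2^k − 3, where β = 1/4 if v ≡ 2 or 6 (mod 8), β = 1/2 if v ≡ 4 (mod 8), and β = 1 if v ≡ 0 (mod 8). -/

import Mathlib

open scoped Pointwise

/-- `B_con(v,3)`: base lines of connected cyclic configurations of type (v₃). -/
def Bcon3 (v : ℕ) : Set (Finset (ZMod v)) :=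
  {X | X.card = 3 ∧ (X - X).card = 7 ∧
    AddSubgroup.closure ((X - X : Finset (ZMod v)) : Set (ZMod v)) = ⊤}

/-- The orbit relation of the affine group `AGL₁(v)` acting on `B_con(v,3)` by
`X ↦ aX + b`. -/
def affRel3 (v : ℕ) (X Y : Bcon3 v) : Prop :=
  ∃ a : (ZMod v)ˣ, ∃ b : ZMod v,
    (Y : Finset (ZMod v)) = (X : Finset (ZMod v)).image (fun t => (a : ZMod v) * t + b)

/-- The number of orbits of `AGL₁(v)` on `B_con(v,3)`, i.e. the number of isomorphism
classes of connected cyclic configurations of type (v₃). -/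
noncomputable def numOrbits3 (v : ℕ) : ℕ :=
  Nat.card (Quot (affRel3 v))

theorem isLocalRing_zmod_prime_pow {p k : ℕ} (hp : p.Prime) (hk : k ≠ 0) :
    IsLocalRing (ZMod (p ^ k)) := by
  have : Fact p.Prime := ⟨hp⟩
  have : Fact (1 < p ^ k) := ⟨Nat.one_lt_pow hk hp.one_lt⟩
  exact IsLocalRing.of_surjective' (PadicInt.toZModPow (p := p) k) (ZMod.ringHom_surjective _)

theorem IsLocalRing.isCoprime_iff {R : Type*} [CommRing R] [IsLocalRing R] {a b : R} :
    IsCoprime a b ↔ IsUnit a ∨ IsUnit b := by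
  constructor
  · rintro ⟨u, w, h⟩
    exact (IsLocalRing.isUnit_or_isUnit_of_add_one h).imp isUnit_of_mul_isUnit_right
      isUnit_of_mul_isUnit_right
  · rintro (h | h)
    · exact isCoprime_one_left.of_isCoprime_of_dvd_left h.dvd
    · exact isCoprime_one_right.of_isCoprime_of_dvd_right h.dvd

theorem Prod.isCoprime_iff {R S : Type*} [CommSemiring R] [CommSemiring S] {a b : R × S} :
    IsCoprime a b ↔ IsCoprime a.1 b.1 ∧ IsCoprime a.2 b.2 := by
  constructor
  · intro h
    exact ⟨h.map (RingHom.fst R S), h.map (RingHom.snd R S)⟩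
  · rintro ⟨⟨u, w, h⟩, u', w', h'⟩
    exact ⟨(u, u'), (w, w'), Prod.ext h h'⟩

theorem RingEquiv.isCoprime_map_iff {R S : Type*} [CommSemiring R] [CommSemiring S] (e : R ≃+* S)
    {a b : R} : IsCoprime (e a) (e b) ↔ IsCoprime a b :=
  ⟨fun h => by simpa using h.map (e.symm : S →+* R), fun h => h.map (e : R →+* S)⟩

/-- The number of coprime pairs in a ring; for `ZMod n` this is the Jordan totient `J₂ n`. -/
noncomputable def numCoprimePairs (R : Type*) [CommSemiring R] : ℕ :=
  Nat.card {x : R × R // IsCoprime x.1 x.2}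

theorem numCoprimePairs_zmod_mul {m n : ℕ} (h : m.Coprime n) :
    numCoprimePairs (ZMod (m * n)) = numCoprimePairs (ZMod m) * numCoprimePairs (ZMod n) := by
  let e := ZMod.chineseRemainder h
  rw [numCoprimePairs, numCoprimePairs, numCoprimePairs, ← Nat.card_prod]
  refine Nat.card_congr (((e.toEquiv.prodCongr e.toEquiv).trans
    (Equiv.prodProdProdComm _ _ _ _)).subtypeEquiv (fun x => ?_) |>.trans
      (Equiv.subtypeProdEquivProd (p := fun x : ZMod m × ZMod m => IsCoprime x.1 x.2)
        (q := fun x : ZMod n × ZMod n => IsCoprime x.1 x.2)))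
  rw [← e.isCoprime_map_iff, Prod.isCoprime_iff]
  rfl

theorem numCoprimePairs_zmod_prime_pow {p k : ℕ} (hp : p.Prime) (hk : k ≠ 0) :
    (numCoprimePairs (ZMod (p ^ k)) : ℚ) = (p ^ k) ^ 2 * (1 - 1 / (p : ℚ) ^ 2) := by
  classical
  have := isLocalRing_zmod_prime_pow hp hk
  have : NeZero (p ^ k) := ⟨pow_ne_zero _ hp.ne_zero⟩
  have hu : Fintype.card {a : ZMod (p ^ k) // IsUnit a} = (p ^ k).totient := by
    rw [← ZMod.card_units_eq_totient, ← Nat.card_eq_fintype_card, ← Nat.card_eq_fintype_card]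
    exact Nat.card_congr ((Equiv.ofInjective _ Units.val_injective).symm)
  have hn : Fintype.card {a : ZMod (p ^ k) // ¬ IsUnit a} = p ^ (k - 1) := by
    rw [Fintype.card_subtype_compl, hu, ZMod.card, Nat.totient_prime_pow hp (Nat.pos_of_ne_zero hk)]
    obtain ⟨j, rfl⟩ := Nat.exists_eq_succ_of_ne_zero hk
    obtain ⟨q, rfl⟩ := Nat.exists_eq_succ_of_ne_zero hp.ne_zero
    simp [pow_succ, Nat.mul_add]
  have hc : Fintype.card {x : ZMod (p ^ k) × ZMod (p ^ k) // ¬ IsCoprime x.1 x.2} =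
      (p ^ (k - 1)) ^ 2 := by
    rw [sq, ← hn, ← Fintype.card_prod]
    refine Fintype.card_congr ((Equiv.subtypeEquivRight fun x => ?_).trans
      (Equiv.subtypeProdEquivProd (p := fun a : ZMod (p ^ k) => ¬ IsUnit a)
        (q := fun a : ZMod (p ^ k) => ¬ IsUnit a)))
    rw [IsLocalRing.isCoprime_iff, not_or]
  have ht := Fintype.card_subtype_compl (fun x : ZMod (p ^ k) × ZMod (p ^ k) => IsCoprime x.1 x.2)
  have hle := Fintype.card_subtype_le (fun x : ZMod (p ^ k) × ZMod (p ^ k) => IsCoprime x.1 x.2)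
  rw [hc, ← Nat.card_eq_fintype_card (α := Subtype _)] at ht
  rw [← Nat.card_eq_fintype_card (α := Subtype _)] at hle
  change _ = _ - numCoprimePairs _ at ht
  change numCoprimePairs _ ≤ _ at hle
  rw [Fintype.card_prod, ZMod.card] at ht hle
  have h : (p ^ (k - 1)) ^ 2 + numCoprimePairs (ZMod (p ^ k)) = p ^ k * p ^ k := by omega
  have h' : ((p : ℚ) ^ (k - 1)) ^ 2 + numCoprimePairs (ZMod (p ^ k)) = p ^ k * p ^ k := by
    exact_mod_cast h
  obtain ⟨j, rfl⟩ := Nat.exists_eq_succ_of_ne_zero hk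
  have : (p : ℚ) ≠ 0 := by exact_mod_cast hp.ne_zero
  rw [← eq_sub_iff_add_eq'] at h'
  rw [h']
  simp only [Nat.succ_eq_add_one, Nat.add_sub_cancel]
  field_simp
  ring

theorem numCoprimePairs_zmod_one : numCoprimePairs (ZMod 1) = 1 := by
  rw [numCoprimePairs, Nat.card_eq_one_iff_unique]
  exact ⟨inferInstance, ⟨⟨(0, 0), 0, 0, Subsingleton.elim _ _⟩⟩⟩

theorem numCoprimePairs_zmod {n : ℕ} (hn : n ≠ 0) :
    (numCoprimePairs (ZMod n) : ℚ) = n ^ 2 * ∏ p ∈ n.primeFactors, (1 - 1 / (p : ℚ) ^ 2) := by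
  rw [Nat.multiplicative_factorization (fun n => (numCoprimePairs (ZMod n) : ℚ))
    (fun m n h => by rw [numCoprimePairs_zmod_mul h, Nat.cast_mul])
    (by simp [numCoprimePairs_zmod_one]) hn]
  have h : (n : ℚ) ^ 2 = ∏ p ∈ n.primeFactors, ((p : ℚ) ^ n.factorization p) ^ 2 := by
    rw [Finset.prod_pow]
    nth_rw 1 [← Nat.prod_factorization_pow_eq_self hn]
    simp [Finsupp.prod]
  rw [h, ← Finset.prod_mul_distrib, Finsupp.prod, Nat.support_factorization]
  exact Finset.prod_congr rfl fun p hp =>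
    numCoprimePairs_zmod_prime_pow (Nat.prime_of_mem_primeFactors hp)
      (Finsupp.mem_support_iff.mp (Nat.support_factorization n ▸ hp))

/-- The number of square roots of one in a ring. -/
noncomputable def numSqrtOne (R : Type*) [CommSemiring R] : ℕ :=
  Nat.card {x : R // x ^ 2 = 1}

theorem numSqrtOne_zmod_mul {m n : ℕ} (h : m.Coprime n) :
    numSqrtOne (ZMod (m * n)) = numSqrtOne (ZMod m) * numSqrtOne (ZMod n) := by
  let e := ZMod.chineseRemainder h
  rw [numSqrtOne, numSqrtOne, numSqrtOne, ← Nat.card_prod]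
  refine Nat.card_congr ((e.toEquiv.subtypeEquiv fun x => ?_).trans
      (Equiv.subtypeProdEquivProd (p := fun x : ZMod m => x ^ 2 = 1)
        (q := fun x : ZMod n => x ^ 2 = 1)))
  rw [← map_eq_one_iff e e.injective, map_pow, Prod.ext_iff]
  rfl

theorem numSqrtOne_zmod_one : numSqrtOne (ZMod 1) = 1 := by
  rw [numSqrtOne, Nat.card_eq_one_iff_unique]
  exact ⟨inferInstance, ⟨⟨0, Subsingleton.elim _ _⟩⟩⟩

theorem numSqrtOne_eq_two {R : Type*} [CommRing R] [IsLocalRing R] (h2 : IsUnit (2 : R)) :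
    numSqrtOne R = 2 := by
  have hne : (1 : R) ≠ -1 := by
    intro h
    have : (2 : R) = 0 := by linear_combination h
    exact not_isUnit_zero (this ▸ h2)
  have hs : {x : R | x ^ 2 = 1} = {1, -1} := by
    ext x
    simp only [Set.mem_ofPred_eq, Set.mem_insert_iff, Set.mem_singleton_iff]
    refine ⟨fun hx => ?_, by rintro (rfl | rfl) <;> ring⟩
    have h : (1 + x) + (1 - x) = 2 := by ring
    have h0 : (1 + x) * (1 - x) = 0 := by linear_combination -hx
    rcases IsLocalRing.isUnit_or_isUnit_of_isUnit_add (h ▸ h2) with hu | hu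
    · left; linear_combination -(hu.mul_right_eq_zero.mp h0)
    · right; linear_combination hu.mul_left_eq_zero.mp h0
  rw [← Set.ncard_pair hne, ← hs]
  rfl

theorem numSqrtOne_zmod_odd {m : ℕ} (hm : Odd m) :
    numSqrtOne (ZMod m) = 2 ^ m.primeFactors.card := by
  have hm0 : m ≠ 0 := by rintro rfl; simp at hm
  rw [Nat.multiplicative_factorization (fun n => numSqrtOne (ZMod n))
    (fun m n h => numSqrtOne_zmod_mul h) numSqrtOne_zmod_one hm0, Finsupp.prod,
    Nat.support_factorization, ← Finset.prod_const]
  refine Finset.prod_congr rfl fun p hp => ?_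
  have hp' := Nat.prime_of_mem_primeFactors hp
  have := isLocalRing_zmod_prime_pow hp'
    (Finsupp.mem_support_iff.mp (Nat.support_factorization m ▸ hp))
  refine numSqrtOne_eq_two ?_
  have h2 : Nat.Coprime 2 (p ^ m.factorization p) :=
    Nat.Coprime.pow_right _
      (Nat.coprime_two_left.mpr (hm.of_dvd_nat (Nat.dvd_of_mem_primeFactors hp)))
  exact_mod_cast (ZMod.isUnit_iff_coprime 2 _).mpr h2

theorem numSqrtOne_zmod_two : numSqrtOne (ZMod 2) = 1 := by
  rw [numSqrtOne, Nat.card_eq_fintype_card]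
  decide

theorem numSqrtOne_zmod_four : numSqrtOne (ZMod 4) = 2 := by
  rw [numSqrtOne, Nat.card_eq_fintype_card]
  decide

theorem sq_eq_one_zmod_two_pow {j : ℕ} {x : ZMod (2 ^ (j + 3))} :
    x ^ 2 = 1 ↔ x = 1 ∨ x = -1 ∨ x = 1 + 2 ^ (j + 2) ∨ x = -1 + 2 ^ (j + 2) := by
  have hN : (2 : ZMod (2 ^ (j + 3))) ^ (j + 3) = 0 := by
    exact_mod_cast ZMod.natCast_self (2 ^ (j + 3))
  constructor
  · intro hx
    obtain ⟨a, rfl⟩ := ZMod.intCast_surjective x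
    have hd : (2 : ℤ) ^ (j + 3) ∣ a ^ 2 - 1 := by
      have := (ZMod.intCast_zmod_eq_zero_iff_dvd (a ^ 2 - 1) (2 ^ (j + 3))).mp
        (by push_cast; rw [hx, sub_self])
      exact_mod_cast this
    have hodd : Odd a := by
      have h2 : (2 : ℤ) ∣ a ^ 2 - 1 := (dvd_pow_self 2 (by omega)).trans hd
      rcases Int.even_or_odd a with ⟨c, rfl⟩ | h
      · ring_nf at h2; omega
      · exact h
    obtain ⟨b, rfl⟩ := hodd
    have hb : (2 : ℤ) ^ (j + 1) ∣ b * (b + 1) := by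
      obtain ⟨c, hc⟩ := hd
      exact ⟨c, by rw [pow_add] at hc ⊢; linarith⟩
    have key : ∀ c : ℤ, (2 : ZMod (2 ^ (j + 3))) ^ (j + 2) * c = 0 ∨
        (2 : ZMod (2 ^ (j + 3))) ^ (j + 2) * c = 2 ^ (j + 2) := by
      intro c
      rcases Int.even_or_odd c with ⟨d, rfl⟩ | ⟨d, rfl⟩
      · left; push_cast; linear_combination (d : ZMod (2 ^ (j + 3))) * hN
      · right; push_cast; linear_combination (d : ZMod (2 ^ (j + 3))) * hN
    rcases Int.even_or_odd b with hbe | hbo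
    · obtain ⟨c, rfl⟩ := Int.prime_two.pow_dvd_of_dvd_mul_right (j + 1)
        (by have := hbe.add_one; rwa [← Int.not_even_iff_odd, even_iff_two_dvd] at this) hb
      rcases key c with h | h
      · left; push_cast; linear_combination h
      · right; right; left; push_cast; linear_combination h
    · obtain ⟨c, hc⟩ := Int.prime_two.pow_dvd_of_dvd_mul_left (j + 1)
        (by rwa [← Int.not_even_iff_odd, even_iff_two_dvd] at hbo) hb
      obtain rfl : b = 2 ^ (j + 1) * c - 1 := by linarith
      rcases key c with h | h
      · right; left; push_cast; linear_combination h
      · right; right; right; push_cast; linear_combination h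
  · rintro (rfl | rfl | rfl | rfl)
    · ring
    · ring
    · linear_combination (1 + 2 ^ (j + 1)) * hN
    · linear_combination (-1 + 2 ^ (j + 1)) * hN

theorem numSqrtOne_zmod_two_pow (j : ℕ) : numSqrtOne (ZMod (2 ^ (j + 3))) = 4 := by
  set h : ZMod (2 ^ (j + 3)) := 2 ^ (j + 2) with hh
  have ne0 : ∀ n : ℕ, 0 < n → n < 2 ^ (j + 3) → (n : ZMod (2 ^ (j + 3))) ≠ 0 := by
    intro n h0 h1 hn
    exact absurd (Nat.le_of_dvd h0 ((ZMod.natCast_eq_zero_iff _ _).mp hn)) (by omega)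
  have hpos : 0 < 2 ^ j := by positivity
  have h2 : (2 : ZMod (2 ^ (j + 3))) ≠ 0 := by
    exact_mod_cast ne0 2 (by omega) (by rw [pow_add]; omega)
  have hne : h ≠ 0 := by
    rw [hh]; exact_mod_cast ne0 (2 ^ (j + 2)) (by positivity) (by rw [pow_add, pow_add]; omega)
  have hp2 : h + 2 ≠ 0 := by
    rw [hh]; exact_mod_cast ne0 (2 ^ (j + 2) + 2) (by positivity) (by rw [pow_add, pow_add]; omega)
  have hh0 : h + h = 0 := by
    have : ((2 ^ (j + 3) : ℕ) : ZMod (2 ^ (j + 3))) = 0 := ZMod.natCast_self _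
    push_cast at this
    rw [← this, hh]; ring
  have hs : {x : ZMod (2 ^ (j + 3)) | x ^ 2 = 1} =
      (({1, -1, 1 + h, -1 + h} : Finset (ZMod (2 ^ (j + 3)))) : Set (ZMod (2 ^ (j + 3)))) := by
    ext x
    simpa using sq_eq_one_zmod_two_pow
  change Set.ncard {x : ZMod (2 ^ (j + 3)) | x ^ 2 = 1} = 4
  rw [hs, Set.ncard_coe_finset]
  rw [Finset.card_insert_of_notMem, Finset.card_insert_of_notMem, Finset.card_pair]
  · exact fun e => h2 (by linear_combination e)
  · simp only [Finset.mem_insert, Finset.mem_singleton, not_or]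
    exact ⟨fun e => hp2 (by linear_combination -e), fun e => hne (by linear_combination -e)⟩
  · simp only [Finset.mem_insert, Finset.mem_singleton, not_or]
    exact ⟨fun e => h2 (by linear_combination e), fun e => hne (by linear_combination -e),
      fun e => hp2 (by linear_combination e + hh0)⟩

theorem numSqrtOne_zmod_even {v : ℕ} (hv : v ≠ 0) (heven : Even v) :
    (numSqrtOne (ZMod v) : ℚ) =
      2 * ((if v % 8 = 0 then (1 : ℚ) else if v % 8 = 4 then 1 / 2 else 1 / 4) *
        2 ^ v.primeFactors.card) := by
  obtain ⟨a, m, hm, rfl⟩ := Nat.exists_eq_two_pow_mul_odd hv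
  have ha : a ≠ 0 := by
    rintro rfl
    exact Nat.not_even_iff_odd.mpr hm (by simpa using heven)
  have hcop : Nat.Coprime (2 ^ a) m := Nat.Coprime.pow_left _ (Nat.coprime_two_left.mpr hm)
  rw [numSqrtOne_zmod_mul hcop, numSqrtOne_zmod_odd hm, hcop.primeFactors_mul,
    Finset.card_union_of_disjoint hcop.disjoint_primeFactors,
    Nat.primeFactors_prime_pow ha Nat.prime_two, Finset.card_singleton, pow_add]
  obtain ⟨b, rfl⟩ := hm
  match a with
  | 1 =>
    rw [if_neg (by omega), if_neg (by omega), pow_one, numSqrtOne_zmod_two]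
    push_cast; ring
  | 2 =>
    rw [if_neg (by omega), if_pos (by omega), show 2 ^ 2 = 4 from rfl, numSqrtOne_zmod_four]
    push_cast; ring
  | j + 3 =>
    rw [if_pos (Nat.mod_eq_zero_of_dvd (Dvd.dvd.mul_right ⟨2 ^ j, by ring⟩ _)),
      numSqrtOne_zmod_two_pow]
    push_cast; ring

/-- Unimodular triples with zero sum: the side vectors of the triangles generating `R`. -/
structure UniTriple (R : Type*) [CommRing R] where
  /-- The entries of the triple. -/
  toFun : Fin 3 → R
  sum_toFun : ∑ i, toFun i = 0
  unimodular : ∃ c : Fin 3 → R, ∑ i, c i * toFun i = 1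

namespace UniTriple

variable {R : Type*} [CommRing R]

instance : CoeFun (UniTriple R) (fun _ => Fin 3 → R) := ⟨toFun⟩

theorem toFun_injective : Function.Injective (toFun (R := R)) := by
  rintro ⟨f, _, _⟩ ⟨g, _, _⟩ rfl
  rfl

instance [Finite R] : Finite (UniTriple R) := Finite.of_injective _ toFun_injective

instance : MulAction (Rˣ × Equiv.Perm (Fin 3)) (UniTriple R) where
  smul g f := ⟨fun i => g.1 * f (g.2⁻¹ i), by
    rw [← Finset.mul_sum, Equiv.sum_comp g.2⁻¹ f, f.sum_toFun, mul_zero], by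
    obtain ⟨c, hc⟩ := f.unimodular
    refine ⟨fun i => ↑g.1⁻¹ * c (g.2⁻¹ i), ?_⟩
    rw [← hc, ← Equiv.sum_comp g.2⁻¹ (fun i => c i * f i)]
    refine Finset.sum_congr rfl fun i _ => ?_
    linear_combination c (g.2⁻¹ i) * f (g.2⁻¹ i) * Units.inv_mul g.1⟩
  one_smul f := toFun_injective (funext fun i => one_mul (f i))
  mul_smul g h f := toFun_injective (funext fun i => by
    change ((g.1 * h.1 : Rˣ) : R) * f ((g.2 * h.2)⁻¹ i) = g.1 * (h.1 * f (h.2⁻¹ (g.2⁻¹ i)))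
    rw [Units.val_mul, mul_assoc, mul_inv_rev, Equiv.Perm.mul_apply])

theorem smul_apply (g : Rˣ × Equiv.Perm (Fin 3)) (f : UniTriple R) (i : Fin 3) :
    (g • f) i = g.1 * f (g.2⁻¹ i) := rfl

theorem sum_eq_zero (f : UniTriple R) : f 0 + f 1 + f 2 = 0 := by
  rw [← f.sum_toFun, Fin.sum_univ_three]

@[ext] theorem ext_two {f g : UniTriple R} (h0 : f 0 = g 0) (h1 : f 1 = g 1) : f = g := by
  refine toFun_injective (funext fun i => ?_)
  fin_cases i
  · exact h0
  · exact h1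
  · change f 2 = g 2
    linear_combination f.sum_eq_zero - g.sum_eq_zero - h0 - h1

theorem isCoprime (f : UniTriple R) : IsCoprime (f 0) (f 1) := by
  obtain ⟨c, hc⟩ := f.unimodular
  rw [Fin.sum_univ_three] at hc
  exact ⟨c 0 - c 2, c 1 - c 2, by linear_combination hc - c 2 * f.sum_eq_zero⟩

/-- The unimodular triple with prescribed first two entries. -/
def ofCoprime (a b : R) (h : IsCoprime a b) : UniTriple R :=
  ⟨![a, b, -(a + b)], by simp [Fin.sum_univ_three], by
    obtain ⟨u, w, h⟩ := h
    exact ⟨![u, w, 0], by simpa [Fin.sum_univ_three] using h⟩⟩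

@[simp] theorem ofCoprime_zero (a b : R) (h) : ofCoprime a b h 0 = a := rfl

@[simp] theorem ofCoprime_one (a b : R) (h) : ofCoprime a b h 1 = b := rfl

theorem card_eq_numCoprimePairs : Nat.card (UniTriple R) = numCoprimePairs R :=
  Nat.card_congr
    { toFun f := ⟨(f 0, f 1), f.isCoprime⟩
      invFun x := ofCoprime x.1.1 x.1.2 x.2
      left_inv _ := ext_two rfl rfl
      right_inv _ := rfl }

theorem eq_one_of_mul_eq {u : R} (f : UniTriple R) (h : ∀ i, u * f i = f i) : u = 1 := by
  obtain ⟨c, hc⟩ := f.unimodular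
  calc u = u * ∑ i, c i * f i := by rw [hc, mul_one]
    _ = ∑ i, c i * f i := by
      rw [Finset.mul_sum]
      exact Finset.sum_congr rfl fun i _ => by rw [mul_left_comm, h]
    _ = 1 := hc

theorem card_fixedBy_one_right [Finite R] [DecidableEq R] (u : Rˣ) :
    Nat.card (MulAction.fixedBy (UniTriple R) (u, (1 : Equiv.Perm (Fin 3)))) =
      if u = 1 then numCoprimePairs R else 0 := by
  split_ifs with h
  · subst h
    rw [← card_eq_numCoprimePairs, ← Prod.one_eq_mk, MulAction.fixedBy_one_eq_univ,
      Nat.card_coe_set_eq, Set.ncard_univ]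
  · rw [Nat.card_coe_set_eq, Set.ncard_eq_zero, Set.eq_empty_iff_forall_notMem]
    intro f hf
    exact h (Units.ext (eq_one_of_mul_eq f fun i => congrArg (fun g : UniTriple R => g i) hf))

theorem card_fixedBy_swap_zero_one [Finite R] (u : Rˣ) :
    Nat.card (MulAction.fixedBy (UniTriple R) (u, Equiv.swap (0 : Fin 3) 1)) =
      Nat.card {_x : Rˣ // u ^ 2 = 1} := by
  have key (f : UniTriple R) : f ∈ MulAction.fixedBy (UniTriple R) (u, Equiv.swap (0 : Fin 3) 1) ↔
      u * f 1 = f 0 ∧ u * f 0 = f 1 := by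
    rw [MulAction.mem_fixedBy, UniTriple.ext_two_iff, smul_apply, smul_apply]
    simp
  refine Nat.card_congr (Equiv.symm
    (Equiv.ofBijective (fun (x : {_x : Rˣ // u ^ 2 = 1}) =>
      ⟨ofCoprime x.1 (u * x.1) ?_, (key _).mpr ?_⟩) ⟨?_, ?_⟩))
  · exact isCoprime_one_left.of_isCoprime_of_dvd_left x.1.isUnit.dvd
  · have := congrArg Units.val x.2
    push_cast at this
    simp only [ofCoprime_zero, ofCoprime_one, and_true]
    linear_combination (x.1 : R) * this
  · intro x y h
    exact Subtype.ext (Units.ext (congrArg (fun g => g.1 0) h))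
  · rintro ⟨f, hf⟩
    have h := (key f).mp hf
    obtain ⟨r, s, hrs⟩ := f.isCoprime
    have hunit : IsUnit (f 0) := IsUnit.of_mul_eq_one (r + s * u) (by
      linear_combination hrs + s * h.2)
    obtain ⟨x, hx⟩ := hunit
    refine ⟨⟨x, ?_⟩, ?_⟩
    · refine mul_right_cancel (b := x) (Units.ext ?_)
      push_cast
      rw [hx]
      linear_combination h.1 + u * h.2
    · refine Subtype.ext (ext_two hx ?_)
      simp only [ofCoprime_one, hx, h.2]

theorem card_fixedBy_conj [Finite R] (u : Rˣ) (σ τ : Equiv.Perm (Fin 3)) :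
    Nat.card (MulAction.fixedBy (UniTriple R) (u, τ * σ * τ⁻¹)) =
      Nat.card (MulAction.fixedBy (UniTriple R) (u, σ)) := by
  have h := MulAction.smul_fixedBy (UniTriple R) (u, σ) (1, τ)
  have he : ((1, τ) * (u, σ) * (1, τ)⁻¹ : Rˣ × Equiv.Perm (Fin 3)) = (u, τ * σ * τ⁻¹) := by
    simp
  rw [he] at h
  rw [← h, Nat.card_coe_set_eq, Nat.card_coe_set_eq, Set.ncard_smul_set]

theorem card_fixedBy_of_three_cycle {v : ℕ} [NeZero v] (heven : Even v) (u : (ZMod v)ˣ)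
    {σ : Equiv.Perm (Fin 3)} (h0 : σ⁻¹ 1 = 0 ∧ σ⁻¹ 2 = 1 ∨ σ⁻¹ 1 = 2 ∧ σ⁻¹ 2 = 0) :
    Nat.card (MulAction.fixedBy (UniTriple (ZMod v)) (u, σ)) = 0 := by
  rw [Nat.card_coe_set_eq, Set.ncard_eq_zero, Set.eq_empty_iff_forall_notMem]
  intro f hf
  let φ : ZMod v →+* ZMod 2 := ZMod.castHom (even_iff_two_dvd.mp heven) (ZMod 2)
  have hu : φ u = 1 := by
    have : ∀ w : (ZMod 2)ˣ, (w : ZMod 2) = 1 := by decide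
    exact this (Units.map φ.toMonoidHom u)
  have hfix (i) : φ (f (σ⁻¹ i)) = φ (f i) := by
    have := congrArg φ (congrArg (fun g : UniTriple (ZMod v) => g i) hf)
    simpa [smul_apply, hu] using this
  have hs := congrArg φ f.sum_eq_zero
  obtain ⟨r, s, hrs⟩ := f.isCoprime
  have hc := congrArg φ hrs
  simp only [map_add, map_mul, map_zero, map_one] at hs hc
  have h1 := hfix 1
  have h2 := hfix 2
  have dec : ∀ a b c r s : ZMod 2, a = b → a = c → a + b + c = 0 → r * a + s * b ≠ 1 := by decide
  rcases h0 with ⟨e1, e2⟩ | ⟨e1, e2⟩ <;> rw [e1] at h1 <;> rw [e2] at h2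
  · exact dec _ _ _ _ _ h1 (h1.trans h2) hs hc
  · exact dec _ _ _ _ _ (h2.trans h1) h2 hs hc

theorem sum_units_card_sq_eq_one [Fintype R] [DecidableEq R] :
    ∑ u : Rˣ, Nat.card {_x : Rˣ // u ^ 2 = 1} = numSqrtOne R * Fintype.card Rˣ := by
  have h : numSqrtOne R = Nat.card {u : Rˣ // u ^ 2 = 1} := by
    refine Nat.card_congr (Equiv.symm (Equiv.ofBijective
      (fun u => ⟨u.1, by rw [← Units.val_pow_eq_pow_val, u.2, Units.val_one]⟩)
      ⟨fun u w h => ?_, fun x => ?_⟩))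
    · exact Subtype.ext (Units.ext (congrArg Subtype.val h))
    · obtain ⟨x, hx⟩ := x
      obtain ⟨u, rfl⟩ := IsUnit.of_pow_eq_one hx two_ne_zero
      exact ⟨⟨u, Units.ext (by rwa [Units.val_pow_eq_pow_val])⟩, rfl⟩
  have h' (u : Rˣ) : Nat.card {_x : Rˣ // u ^ 2 = 1} =
      if u ^ 2 = 1 then Fintype.card Rˣ else 0 := by
    split_ifs with hu <;> simp [hu]
  simp_rw [h']
  rw [h, Finset.sum_ite, Finset.sum_const_zero, add_zero, Finset.sum_const, smul_eq_mul,
    Nat.card_eq_fintype_card, Fintype.card_subtype]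

/-- The orbits of unimodular triples under scaling and permutation. -/
abbrev Orbits (R : Type*) [CommRing R] : Type _ :=
  MulAction.orbitRel.Quotient (Rˣ × Equiv.Perm (Fin 3)) (UniTriple R)

theorem card_orbits {v : ℕ} [NeZero v] (heven : Even v) :
    Nat.card (Orbits (ZMod v)) * (v.totient * 6) =
      numCoprimePairs (ZMod v) + 3 * (numSqrtOne (ZMod v) * v.totient) := by
  classical
  have := Fintype.ofFinite (UniTriple (ZMod v))
  have hb := MulAction.sum_card_fixedBy_eq_card_orbits_mul_card_group
    ((ZMod v)ˣ × Equiv.Perm (Fin 3)) (UniTriple (ZMod v))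
  simp_rw [← Nat.card_eq_fintype_card] at hb
  have hperm : (Finset.univ : Finset (Equiv.Perm (Fin 3))) =
      {1, Equiv.swap 0 1, Equiv.swap 0 2, Equiv.swap 1 2, finRotate 3, (finRotate 3)⁻¹} := by
    decide
  have hswap (u : (ZMod v)ˣ) {σ : Equiv.Perm (Fin 3)}
      (hσ : ∃ τ : Equiv.Perm (Fin 3), σ = τ * Equiv.swap 0 1 * τ⁻¹) :
      Nat.card (MulAction.fixedBy (UniTriple (ZMod v)) (u, σ)) =
        Nat.card {_x : (ZMod v)ˣ // u ^ 2 = 1} := by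
    obtain ⟨τ, rfl⟩ := hσ
    rw [card_fixedBy_conj, card_fixedBy_swap_zero_one]
  rw [Fintype.sum_prod_type_right, hperm, Finset.sum_insert (by decide),
    Finset.sum_insert (by decide), Finset.sum_insert (by decide), Finset.sum_insert (by decide),
    Finset.sum_insert (by decide), Finset.sum_singleton] at hb
  simp_rw [card_fixedBy_one_right, card_fixedBy_swap_zero_one,
    hswap _ (σ := Equiv.swap 0 2) (by decide), hswap _ (σ := Equiv.swap 1 2) (by decide),
    card_fixedBy_of_three_cycle heven _ (σ := finRotate 3) (by decide),
    card_fixedBy_of_three_cycle heven _ (σ := (finRotate 3)⁻¹) (by decide)] at hb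
  rw [sum_units_card_sq_eq_one, Nat.card_prod, Nat.card_eq_fintype_card (α := (ZMod v)ˣ),
    ZMod.card_units_eq_totient, Nat.card_eq_fintype_card (α := Equiv.Perm (Fin 3)),
    Fintype.card_perm] at hb
  simp only [Finset.sum_ite_eq', Finset.mem_univ, if_true, Finset.sum_const_zero, Fintype.card_fin,
    show Nat.factorial 3 = 6 from rfl] at hb
  rw [← hb]
  ring

theorem card_orbits_rat {v : ℕ} (hv : v ≠ 0) (heven : Even v) :
    (Nat.card (Orbits (ZMod v)) : ℚ) =
      (v : ℚ) / 6 * (∏ p ∈ v.primeFactors, (1 + 1 / (p : ℚ))) + numSqrtOne (ZMod v) / 2 := by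
  have : NeZero v := ⟨hv⟩
  have h : (Nat.card (Orbits (ZMod v)) : ℚ) * (v.totient * 6) =
      numCoprimePairs (ZMod v) + 3 * (numSqrtOne (ZMod v) * v.totient) := by
    exact_mod_cast card_orbits heven
  have hφ : (v.totient : ℚ) ≠ 0 := by
    exact_mod_cast (Nat.totient_pos.mpr (Nat.pos_of_ne_zero hv)).ne'
  have hN : (numCoprimePairs (ZMod v) : ℚ) =
      v * (∏ p ∈ v.primeFactors, (1 + 1 / (p : ℚ))) * v.totient := by
    have hprod : ∏ p ∈ v.primeFactors, (1 - 1 / (p : ℚ) ^ 2) =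
        (∏ p ∈ v.primeFactors, (1 + 1 / (p : ℚ))) * ∏ p ∈ v.primeFactors, (1 - (p : ℚ)⁻¹) := by
      rw [← Finset.prod_mul_distrib]
      exact Finset.prod_congr rfl fun p _ => by ring
    rw [numCoprimePairs_zmod hv, Nat.totient_eq_mul_prod_factors, hprod]
    ring
  rw [hN] at h
  refine mul_right_cancel₀ (mul_ne_zero hφ (by norm_num : (6 : ℚ) ≠ 0)) ?_
  rw [h]
  ring

end UniTriple

section Sides

variable {R : Type*} [CommRing R]

/-- The cyclic side vectors of a triangle. -/
def sides (p : Fin 3 → R) : Fin 3 → R := fun i => p (i + 1) - p i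

theorem sum_sides (p : Fin 3 → R) : ∑ i, sides p i = 0 := by
  simp only [sides, Finset.sum_sub_distrib, sub_eq_zero]
  exact Equiv.sum_comp (Equiv.addRight (1 : Fin 3)) p

/-- No entry of the triple is equal to its own negative or to another entry. -/
def IsGeneric (f : Fin 3 → R) : Prop :=
  (∀ i, f i + f i ≠ 0) ∧ ∀ i j, i ≠ j → f i ≠ f j

theorem card_sub_eq_seven_iff [DecidableEq R] (p : Fin 3 → R) :
    (Finset.univ.image p - Finset.univ.image p).card = 7 ↔ IsGeneric (sides p) := by
  set a := p 1 - p 0 with ha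
  set b := p 2 - p 1 with hb
  have hl : Finset.univ.image p - Finset.univ.image p =
      [0, a, b, -(a + b), -a, -b, a + b].toFinset := by
    ext x
    simp only [Finset.mem_sub, Finset.mem_image, Finset.mem_univ, true_and,
      Fin.exists_fin_succ, Fin.exists_fin_zero]
    simp [ha, hb]
    grind
  have hcard : (Finset.univ.image p - Finset.univ.image p).card = 7 ↔
      [0, a, b, -(a + b), -a, -b, a + b].Nodup := by
    rw [hl, ← Multiset.coe_nodup, ← Multiset.toFinset_card_eq_card_iff_nodup]
    rfl
  have h0 : sides p 0 = a := rfl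
  have h1 : sides p 1 = b := rfl
  have h2 : sides p 2 = -(a + b) := by simp only [sides, ha, hb]; grind
  rw [hcard]
  have hg : IsGeneric (sides p) ↔ (a + a ≠ 0 ∧ b + b ≠ 0 ∧ -(a + b) + -(a + b) ≠ 0) ∧
      a ≠ b ∧ a ≠ -(a + b) ∧ b ≠ -(a + b) := by
    rw [IsGeneric, ← h2, ← h0, ← h1]
    constructor
    · rintro ⟨h, h'⟩
      exact ⟨⟨h 0, h 1, h 2⟩, h' 0 1 (by decide), h' 0 2 (by decide), h' 1 2 (by decide)⟩
    · rintro ⟨⟨e0, e1, e2⟩, e01, e02, e12⟩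
      refine ⟨fun i => ?_, fun i j hij => ?_⟩
      · fin_cases i <;> assumption
      · fin_cases i <;> fin_cases j <;>
          first | exact absurd rfl hij | assumption | (symm; assumption)
  rw [hg]
  simp only [List.nodup_cons, List.mem_cons, List.not_mem_nil, or_false, not_or, List.nodup_nil,
    not_false_eq_true, and_true]
  clear hcard hl hg h0 h1 h2
  clear_value a b
  constructor
  · rintro ⟨⟨-, -, -, -, -, -⟩, ⟨h1, h2, h3, -, -⟩, ⟨h4, -, h5, -⟩, ⟨-, -, h6⟩, -⟩
    refine ⟨⟨fun e => h3 ?_, fun e => h5 ?_, fun e => h6 ?_⟩, h1, h2, h4⟩ <;> grind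
  · rintro ⟨⟨h1, h2, h3⟩, h4, h5, h6⟩
    refine ⟨⟨?_, ?_, ?_, ?_, ?_, ?_⟩, ⟨?_, ?_, ?_, ?_, ?_⟩, ⟨?_, ?_, ?_, ?_⟩, ⟨?_, ?_, ?_⟩,
      ⟨?_, ?_⟩, ?_⟩ <;> intro e <;> grind

theorem exists_perm_sides_of_perm : ∀ σ : Equiv.Perm (Fin 3), ∃ τ : Equiv.Perm (Fin 3),
    (∀ i, σ i = τ i ∧ σ (i + 1) = τ i + 1) ∨ ∀ i, σ i = τ i + 1 ∧ σ (i + 1) = τ i := by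
  decide

theorem exists_perm_of_perm_sides : ∀ τ : Equiv.Perm (Fin 3), ∃ σ : Equiv.Perm (Fin 3),
    (∀ i, σ i = τ i ∧ σ (i + 1) = τ i + 1) ∨ ∀ i, σ i = τ i + 1 ∧ σ (i + 1) = τ i := by
  decide

theorem exists_affine_image_iff [DecidableEq R] {p q : Fin 3 → R} (hq : Function.Injective q) :
    (∃ (a : Rˣ) (b : R),
      Finset.univ.image q = (Finset.univ.image p).image (fun t => (a : R) * t + b)) ↔
      ∃ (u : Rˣ) (τ : Equiv.Perm (Fin 3)), ∀ i, sides q i = u * sides p (τ i) := by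
  constructor
  · rintro ⟨a, b, h⟩
    have hex (i : Fin 3) : ∃ j, a * p j + b = q i := by
      have : q i ∈ Finset.univ.image q := Finset.mem_image_of_mem _ (Finset.mem_univ i)
      rw [h] at this
      simpa using this
    choose σ hσ using hex
    have hinj : Function.Injective σ := fun i j hij => hq (by rw [← hσ, ← hσ, hij])
    obtain ⟨τ, hτ | hτ⟩ := exists_perm_sides_of_perm
      (Equiv.ofBijective σ (Finite.injective_iff_bijective.mp hinj))
    · refine ⟨a, τ, fun i => ?_⟩
      obtain ⟨h0, h1⟩ := hτ i
      simp only [Equiv.ofBijective_apply] at h0 h1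
      rw [sides, sides, ← hσ, ← hσ, h0, h1]
      ring
    · refine ⟨-a, τ, fun i => ?_⟩
      obtain ⟨h0, h1⟩ := hτ i
      simp only [Equiv.ofBijective_apply] at h0 h1
      rw [sides, sides, ← hσ, ← hσ, h0, h1, Units.val_neg]
      ring
  · rintro ⟨u, τ, h⟩
    obtain ⟨σ, a, hσ⟩ : ∃ (σ : Equiv.Perm (Fin 3)) (a : Rˣ),
        ∀ i, q (i + 1) - q i = a * (p (σ (i + 1)) - p (σ i)) := by
      obtain ⟨σ, hσ | hσ⟩ := exists_perm_of_perm_sides τ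
      · refine ⟨σ, u, fun i => ?_⟩
        rw [(hσ i).1, (hσ i).2]
        exact h i
      · refine ⟨σ, -u, fun i => ?_⟩
        rw [(hσ i).1, (hσ i).2, Units.val_neg]
        linear_combination (norm := skip) h i
        simp only [sides]
        ring
    have hq' (i : Fin 3) : q i = a * p (σ i) + (q 0 - a * p (σ 0)) := by
      have h0 := hσ 0
      have h1 := hσ 1
      fin_cases i
      · simp
      · simp only [zero_add] at h0
        simp only [Fin.mk_one]
        linear_combination h0
      · simp only [zero_add] at h0
        simp only [Fin.reduceFinMk, Fin.reduceAdd] at h1 ⊢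
        linear_combination h0 + h1
    refine ⟨a, q 0 - a * p (σ 0), ?_⟩
    ext x
    simp only [Finset.mem_image, Finset.mem_univ, true_and, exists_exists_eq_and]
    rw [← σ.exists_congr_right (q := fun i => ↑a * p i + (q 0 - ↑a * p (σ 0)) = x)]
    simp only [← hq']

end Sides

theorem closure_sub_eq_top_iff {v : ℕ} (p : Fin 3 → ZMod v) :
    AddSubgroup.closure
      ((Finset.univ.image p - Finset.univ.image p : Finset (ZMod v)) : Set (ZMod v)) = ⊤ ↔
      ∃ c : Fin 3 → ZMod v, ∑ i, c i * sides p i = 1 := by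
  constructor
  · intro h
    have h1 : (1 : ZMod v) ∈ Ideal.span (Set.range (sides p)) := by
      have hle : AddSubgroup.closure
          ((Finset.univ.image p - Finset.univ.image p : Finset (ZMod v)) : Set (ZMod v)) ≤
          (Ideal.span (Set.range (sides p))).toAddSubgroup := by
        rw [AddSubgroup.closure_le]
        intro x hx
        simp only [Finset.coe_sub, Finset.coe_image, Finset.coe_univ, Set.image_univ] at hx
        obtain ⟨_, ⟨i, rfl⟩, _, ⟨j, rfl⟩, rfl⟩ := hx
        have key (i : Fin 3) : p i - p 0 ∈ Ideal.span (Set.range (sides p)) := by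
          have h0 := Ideal.subset_span (α := ZMod v) (Set.mem_range_self (f := sides p) 0)
          have h1 := Ideal.subset_span (α := ZMod v) (Set.mem_range_self (f := sides p) 1)
          fin_cases i
          · simp
          · exact h0
          · have := add_mem h0 h1
            simpa [sides] using this
        have := sub_mem (key i) (key j)
        simpa using this
      exact hle (h ▸ AddSubgroup.mem_top _)
    obtain ⟨c, hc⟩ := (Ideal.mem_span_range_iff_exists_fun).mp h1
    exact ⟨c, hc⟩
  · rintro ⟨c, hc⟩
    have hmul (r : ZMod v) {x : ZMod v} (H : AddSubgroup (ZMod v)) (hx : x ∈ H) : r * x ∈ H := by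
      obtain ⟨n, rfl⟩ := ZMod.intCast_surjective r
      rw [← zsmul_eq_mul]
      exact zsmul_mem hx n
    rw [eq_top_iff]
    intro x _
    rw [← mul_one x, ← hc]
    refine hmul x _ (sum_mem fun i _ => hmul _ _ (AddSubgroup.subset_closure ?_))
    rw [Finset.mem_coe]
    exact Finset.sub_mem_sub (Finset.mem_image_of_mem _ (Finset.mem_univ _))
      (Finset.mem_image_of_mem _ (Finset.mem_univ _))

namespace UniTriple

section Orbits

variable {R : Type*} [CommRing R]

/-- The orbit of a unimodular triple. -/
def orbit (f : UniTriple R) : Orbits R := Quotient.mk'' f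

theorem orbit_eq_iff {f f' : UniTriple R} :
    orbit f = orbit f' ↔ ∃ g : Rˣ × Equiv.Perm (Fin 3), g • f' = f := by
  rw [orbit, orbit, Quotient.eq'', MulAction.orbitRel_apply, MulAction.mem_orbit_iff]

theorem orbit_smul (g : Rˣ × Equiv.Perm (Fin 3)) (f : UniTriple R) : orbit (g • f) = orbit f :=
  orbit_eq_iff.mpr ⟨g, rfl⟩

theorem orbit_eq_iff_exists {f f' : UniTriple R} :
    orbit f = orbit f' ↔ ∃ (u : Rˣ) (τ : Equiv.Perm (Fin 3)), ∀ i, f i = u * f' (τ i) := by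
  rw [orbit_eq_iff]
  constructor
  · rintro ⟨g, rfl⟩
    exact ⟨g.1, g.2⁻¹, fun i => rfl⟩
  · rintro ⟨u, τ, h⟩
    refine ⟨(u, τ⁻¹), toFun_injective (funext fun i => ?_)⟩
    rw [h, smul_apply, inv_inv]

theorem exists_eq_zero_of_orbit_eq {f f' : UniTriple R} (h : orbit f = orbit f')
    (hf : ∃ i, f i = 0) : ∃ i, f' i = 0 := by
  obtain ⟨u, τ, h⟩ := orbit_eq_iff_exists.mp h
  obtain ⟨i, hi⟩ := hf
  exact ⟨τ i, u.isUnit.mul_right_eq_zero.mp ((h i).symm.trans hi)⟩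

theorem exists_add_self_eq_zero_of_orbit_eq {f f' : UniTriple R} (h : orbit f = orbit f')
    (hf : ∃ i, f i + f i = 0) : ∃ i, f' i + f' i = 0 := by
  obtain ⟨u, τ, h⟩ := orbit_eq_iff_exists.mp h
  obtain ⟨i, hi⟩ := hf
  exact ⟨τ i, u.isUnit.mul_right_eq_zero.mp (by rw [mul_add, ← h i, hi])⟩

theorem isGeneric_of_orbit_eq {f f' : UniTriple R} (h : orbit f = orbit f') (hf' : IsGeneric f') :
    IsGeneric f := by
  refine ⟨fun i hi => ?_, fun i j hij hf => ?_⟩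
  · obtain ⟨j, hj⟩ := exists_add_self_eq_zero_of_orbit_eq h ⟨i, hi⟩
    exact hf'.1 j hj
  · obtain ⟨u, τ, h⟩ := orbit_eq_iff_exists.mp h
    rw [h, h] at hf
    exact hf'.2 _ _ (τ.injective.ne hij) (u.isUnit.mul_left_cancel hf)

theorem orbit_eq_of_zero {f : UniTriple R} (h : f 0 = 0) :
    orbit f = orbit (ofCoprime 0 1 isCoprime_one_right) := by
  obtain ⟨r, s, hrs⟩ := f.isCoprime
  obtain ⟨u, hu⟩ := IsUnit.of_mul_eq_one s (a := f 1) (by linear_combination hrs - r * h)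
  refine orbit_eq_iff.mpr ⟨(u, 1), ext_two ?_ ?_⟩
  · simp [smul_apply, h]
  · simp [smul_apply, hu]

theorem orbit_eq_of_eq {f : UniTriple R} (h : f 0 = f 1) :
    orbit f = orbit (ofCoprime 1 1 isCoprime_one_right) := by
  obtain ⟨r, s, hrs⟩ := f.isCoprime
  obtain ⟨u, hu⟩ := IsUnit.of_mul_eq_one (r + s) (a := f 0) (by linear_combination hrs + s * h)
  refine orbit_eq_iff.mpr ⟨(u, 1), ext_two ?_ ?_⟩
  · simp [smul_apply, hu]
  · simp [smul_apply, hu, h]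

/-- If `e` is the only element of additive order two, then one of two elements that differ by `e`
and generate the ring together with `e` is a unit. -/
theorem isUnit_or_isUnit_add {e b : R} (he : e + e = 0) (h2 : ∀ x : R, x + x = 0 → x = 0 ∨ x = e)
    (hb : IsCoprime e b) : IsUnit b ∨ IsUnit (e + b) := by
  obtain ⟨r, s, hrs⟩ := hb
  rcases h2 (e * e) (by linear_combination e * he) with hee | hee
  · exact .inl (IsUnit.of_mul_eq_one (s * (1 + r * e)) (by
      linear_combination (1 + r * e) * hrs - r ^ 2 * hee))
  · rcases h2 (b * e) (by linear_combination b * he) with hbe | hbe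
    · exact .inr (IsUnit.of_mul_eq_one (s * (1 - e) + e) (by
        linear_combination (1 - e) * hrs + (1 - s + r) * hee + hbe))
    · exact .inl (IsUnit.of_mul_eq_one (s * (1 - e) + e) (by
        linear_combination (1 - e) * hrs + r * hee + hbe))

theorem orbit_eq_of_involution {e : R} (he : e + e = 0) (he0 : e ≠ 0)
    (h2 : ∀ x : R, x + x = 0 → x = 0 ∨ x = e) {f : UniTriple R} (h : f 0 = e) :
    orbit f = orbit (ofCoprime e 1 isCoprime_one_right) := by
  have key {f : UniTriple R} (h : f 0 = e) (hu : IsUnit (f 1)) :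
      orbit f = orbit (ofCoprime e 1 isCoprime_one_right) := by
    obtain ⟨u, hu⟩ := hu
    have hue : u * e = e := (h2 (u * e) (by linear_combination (u : R) * he)).resolve_left
      fun h => he0 (u.isUnit.mul_right_eq_zero.mp h)
    refine orbit_eq_iff.mpr ⟨(u, 1), ext_two ?_ ?_⟩
    · simp [smul_apply, hue, h]
    · simp [smul_apply, hu]
  rcases isUnit_or_isUnit_add he h2 (h ▸ f.isCoprime) with hu | hu
  · exact key h hu
  · rw [← orbit_smul (1, Equiv.swap 1 2) f]
    refine key ?_ ?_
    · simpa [smul_apply, Equiv.swap_apply_of_ne_of_ne] using h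
    · have : f 2 = -(e + f 1) := by linear_combination f.sum_eq_zero - h
      simpa [smul_apply, this] using hu.neg

theorem orbit_mem_of_not_isGeneric {e : R} (he : e + e = 0) (he0 : e ≠ 0)
    (h2 : ∀ x : R, x + x = 0 → x = 0 ∨ x = e) {f : UniTriple R} (hf : ¬ IsGeneric f) :
    orbit f = orbit (ofCoprime 0 1 isCoprime_one_right) ∨
      orbit f = orbit (ofCoprime e 1 isCoprime_one_right) ∨
      orbit f = orbit (ofCoprime 1 1 isCoprime_one_right) := by
  rw [IsGeneric, not_and_or] at hf
  push Not at hf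
  rcases hf with ⟨i, hi⟩ | ⟨i, j, hij, h⟩
  · rw [← orbit_smul (1, Equiv.swap 0 i) f]
    have h0 : (((1 : Rˣ), Equiv.swap 0 i) • f) 0 = f i := by simp [smul_apply]
    rcases h2 _ hi with h | h
    · exact .inl (orbit_eq_of_zero (h0.trans h))
    · exact .inr (.inl (orbit_eq_of_involution he he0 h2 (h0.trans h)))
  · have hσ : ∀ i j : Fin 3, i ≠ j → ∃ σ : Equiv.Perm (Fin 3), σ⁻¹ 0 = i ∧ σ⁻¹ 1 = j := by decide
    obtain ⟨σ, rfl, rfl⟩ := hσ i j hij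
    rw [← orbit_smul (1, σ) f]
    exact .inr (.inr (orbit_eq_of_eq (by rw [smul_apply, smul_apply, h])))

end Orbits

/-- The three orbits of the triples that are not generic. -/
def degenerateOrbits (R : Type*) [CommRing R] (e : R) : Set (Orbits R) :=
  {orbit (ofCoprime 0 1 isCoprime_one_right), orbit (ofCoprime e 1 isCoprime_one_right),
    orbit (ofCoprime 1 1 isCoprime_one_right)}

section Degenerate

variable {R : Type*} [CommRing R] {e : R}

theorem isGeneric_iff (he : e + e = 0) (he0 : e ≠ 0)
    (h2 : ∀ x : R, x + x = 0 → x = 0 ∨ x = e) {f : UniTriple R} :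
    IsGeneric f ↔ orbit f ∉ degenerateOrbits R e := by
  constructor
  · rintro hf (h | h | h) <;> have hg := isGeneric_of_orbit_eq h.symm hf
    · exact hg.1 0 (by simp)
    · exact hg.1 0 (by simpa using he)
    · exact hg.2 0 1 (by decide) (by simp)
  · intro h
    by_contra hf
    exact h (orbit_mem_of_not_isGeneric he he0 h2 hf)

theorem ncard_degenerateOrbits (he : e + e = 0) (he0 : e ≠ 0) (he1 : e + 1 ≠ 0)
    (h1 : (1 : R) ≠ 0) (h2 : (2 : R) ≠ 0) (h4 : (4 : R) ≠ 0) :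
    (degenerateOrbits R e).ncard = 3 := by
  rw [degenerateOrbits, Set.ncard_eq_three]
  refine ⟨_, _, _, fun h => ?_, fun h => ?_, fun h => ?_, rfl⟩
  · obtain ⟨i, hi⟩ := exists_eq_zero_of_orbit_eq h ⟨0, rfl⟩
    fin_cases i
    · exact he0 hi
    · exact h1 hi
    · exact he1 (neg_eq_zero.mp hi)
  · obtain ⟨i, hi⟩ := exists_eq_zero_of_orbit_eq h ⟨0, rfl⟩
    fin_cases i
    · exact h1 hi
    · exact h1 hi
    · exact h2 (by linear_combination neg_eq_zero.mp hi)
  · obtain ⟨i, hi⟩ := exists_add_self_eq_zero_of_orbit_eq h ⟨0, he⟩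
    fin_cases i
    · exact h2 (one_add_one_eq_two.symm.trans hi)
    · exact h2 (one_add_one_eq_two.symm.trans hi)
    · have h : -((1 : R) + 1) + -(1 + 1) = 0 := hi
      exact h4 (by linear_combination -h)

end Degenerate

end UniTriple

theorem exists_injective_image_eq {α : Type*} [DecidableEq α] {X : Finset α} (h : X.card = 3) :
    ∃ p : Fin 3 → α, Function.Injective p ∧ Finset.univ.image p = X := by
  refine ⟨fun i => (X.equivFinOfCardEq h).symm i,
    Subtype.val_injective.comp (Equiv.injective _), ?_⟩
  ext x
  simp only [Finset.mem_image, Finset.mem_univ, true_and]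
  exact ⟨by rintro ⟨i, rfl⟩; exact Subtype.property _,
    fun hx => ⟨X.equivFinOfCardEq h ⟨x, hx⟩, by simp⟩⟩

namespace Bcon3

variable {v : ℕ}

/-- A labelling of the points of a base line. -/
noncomputable def label (X : Bcon3 v) : Fin 3 → ZMod v :=
  (exists_injective_image_eq X.2.1).choose

theorem label_injective (X : Bcon3 v) : Function.Injective (label X) :=
  (exists_injective_image_eq X.2.1).choose_spec.1

theorem image_label (X : Bcon3 v) : Finset.univ.image (label X) = (X : Finset (ZMod v)) :=
  (exists_injective_image_eq X.2.1).choose_spec.2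

/-- The side vectors of a labelled base line. -/
noncomputable def triple (X : Bcon3 v) : UniTriple (ZMod v) where
  toFun := sides (label X)
  sum_toFun := sum_sides _
  unimodular := (closure_sub_eq_top_iff _).mp (by rw [image_label]; exact X.2.2.2)

theorem isGeneric_triple (X : Bcon3 v) : IsGeneric (triple X) :=
  (card_sub_eq_seven_iff (label X)).mp (by rw [image_label]; exact X.2.2.1)

theorem affRel3_iff {X Y : Bcon3 v} : affRel3 v X Y ↔ (triple X).orbit = (triple Y).orbit := by
  rw [eq_comm, UniTriple.orbit_eq_iff_exists, affRel3]
  refine Iff.trans ?_ (exists_affine_image_iff (label_injective Y))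
  rw [image_label, image_label]

theorem exists_triple_orbit_eq {f : UniTriple (ZMod v)} (hf : IsGeneric f) :
    ∃ X : Bcon3 v, (triple X).orbit = f.orbit := by
  have hs : sides ![0, f 0, f 0 + f 1] = f := by
    funext i
    fin_cases i
    · simp [sides]
    · simp [sides]
    · change 0 - (f 0 + f 1) = f 2
      linear_combination -f.sum_eq_zero
  have hinj : Function.Injective ![0, f 0, f 0 + f 1] := by
    have h0 : f 0 ≠ 0 := fun h => hf.1 0 (by rw [h, add_zero])
    have h1 : f 1 ≠ 0 := fun h => hf.1 1 (by rw [h, add_zero])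
    have h01 : f 0 + f 1 ≠ 0 := fun h => hf.1 2 (by linear_combination 2 * f.sum_eq_zero - 2 * h)
    intro i j hij
    fin_cases i <;> fin_cases j <;> first | rfl | exfalso
    · exact h0 hij.symm
    · exact h01 hij.symm
    · exact h0 hij
    · exact h1 (left_eq_add.mp hij)
    · exact h01 hij
    · exact h1 (add_eq_left.mp hij)
  let X : Bcon3 v := ⟨Finset.univ.image ![0, f 0, f 0 + f 1],
    by rw [Finset.card_image_of_injective _ hinj, Finset.card_univ, Fintype.card_fin],
    (card_sub_eq_seven_iff _).mpr (by rwa [hs]),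
    (closure_sub_eq_top_iff _).mpr (by rw [hs]; exact f.unimodular)⟩
  refine ⟨X, UniTriple.orbit_eq_iff_exists.mpr ?_⟩
  rw [← hs]
  exact (exists_affine_image_iff (label_injective X)).mp ⟨1, 0, by simp [image_label, X]⟩

theorem numOrbits3_eq [NeZero v] {e : ZMod v} (he : e + e = 0) (he0 : e ≠ 0)
    (h2 : ∀ x : ZMod v, x + x = 0 → x = 0 ∨ x = e) :
    numOrbits3 v + (UniTriple.degenerateOrbits (ZMod v) e).ncard =
      Nat.card (UniTriple.Orbits (ZMod v)) := by
  let F : Quot (affRel3 v) → UniTriple.Orbits (ZMod v) :=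
    Quot.lift (fun X => (triple X).orbit) fun _ _ h => affRel3_iff.mp h
  have hF : Function.Injective F := by
    rintro ⟨X⟩ ⟨Y⟩ h
    exact Quot.sound (affRel3_iff.mpr h)
  have hrange : Set.range F = (UniTriple.degenerateOrbits (ZMod v) e)ᶜ := by
    ext o
    obtain ⟨f, rfl⟩ := Quotient.exists_rep o
    change _ ↔ f.orbit ∉ _
    rw [← UniTriple.isGeneric_iff he he0 h2]
    constructor
    · rintro ⟨⟨X⟩, hX⟩
      exact UniTriple.isGeneric_of_orbit_eq (f' := triple X) hX.symm (isGeneric_triple X)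
    · intro hf
      obtain ⟨X, hX⟩ := exists_triple_orbit_eq hf
      exact ⟨Quot.mk _ X, hX⟩
  rw [numOrbits3, ← Nat.card_range_of_injective hF, hrange, Nat.card_coe_set_eq, add_comm,
    Set.ncard_add_ncard_compl]

end Bcon3

theorem ZMod.eq_zero_or_eq_of_add_self_eq_zero {m : ℕ} (hm : m ≠ 0) (x : ZMod (m + m))
    (hx : x + x = 0) : x = 0 ∨ x = m := by
  have : NeZero (m + m) := ⟨by omega⟩
  obtain ⟨n, hn, rfl⟩ : ∃ n < m + m, (n : ZMod (m + m)) = x :=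
    ⟨x.val, x.val_lt, ZMod.natCast_zmod_val x⟩
  obtain ⟨c, hc⟩ := (ZMod.natCast_eq_zero_iff (n + n) (m + m)).mp (by exact_mod_cast hx)
  have hn' : n = m * c := by linarith
  have hc2 : c < 2 := by
    by_contra h
    have : m * 2 ≤ m * c := Nat.mul_le_mul_left m (by omega)
    omega
  interval_cases c
  · left; simp [hn']
  · right; simp [hn']

/-- for even `v > 4`, the number of isomorphism classes of connected
cyclic configurations of type (v₃) is `(1/6)·v·∏(1 + 1/pᵢ) + β·2^k - 3`, where
`β = 1/4` if `v ≡ 2, 6 (mod 8)`, `β = 1/2` if `v ≡ 4 (mod 8)`, and `β = 1`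
if `v ≡ 0 (mod 8)`. -/
theorem numOrbits3_even
    (v : ℕ) (hv : 4 < v) (heven : Even v) :
    (numOrbits3 v : ℚ) =
      (v : ℚ) / 6 * (∏ p ∈ v.primeFactors, (1 + 1 / (p : ℚ)))
        + (if v % 8 = 0 then (1 : ℚ) else if v % 8 = 4 then 1 / 2 else 1 / 4)
            * 2 ^ v.primeFactors.card - 3 := by
  have hne : v ≠ 0 := by omega
  have : NeZero v := ⟨hne⟩
  have hN := UniTriple.card_orbits_rat hne heven
  rw [numSqrtOne_zmod_even hne heven] at hN
  suffices h : numOrbits3 v + 3 = Nat.card (UniTriple.Orbits (ZMod v)) by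
    have h' : (numOrbits3 v : ℚ) + 3 = Nat.card (UniTriple.Orbits (ZMod v)) := by exact_mod_cast h
    linear_combination h' + hN
  have natCast_ne_zero {n : ℕ} (h0 : 0 < n) (h1 : n < v) : (n : ZMod v) ≠ 0 := fun h =>
    absurd (Nat.le_of_dvd h0 ((ZMod.natCast_eq_zero_iff _ _).mp h)) (by omega)
  obtain ⟨m, rfl⟩ := heven
  have he : (m : ZMod (m + m)) + m = 0 := by exact_mod_cast ZMod.natCast_self (m + m)
  have he0 : (m : ZMod (m + m)) ≠ 0 := natCast_ne_zero (by omega) (by omega)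
  rw [← Bcon3.numOrbits3_eq he he0 (ZMod.eq_zero_or_eq_of_add_self_eq_zero (by omega)),
    UniTriple.ncard_degenerateOrbits he he0]
  · exact_mod_cast natCast_ne_zero (n := m + 1) (by omega) (by omega)
  · exact_mod_cast natCast_ne_zero (n := 1) (by omega) (by omega)
  · exact_mod_cast natCast_ne_zero (n := 2) (by omega) (by omega)
  · exact_mod_cast natCast_ne_zero (n := 4) (by omega) (by omega)
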